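/- arXiv:2005.14631 — 4 statements merged into one kernel-verified Lean document; each statement's English description precedes it below -/
import Mathlib

section
/- Let N ≥ 1 be a natural number. Let c : ℕ → ℕ be a nondecreasing sequence (total coins in circulation) with c(t) → ∞, and let n : ℕ → ℕ (community sizes) satisfy 1 ≤ n(s) ≤ N for all s ≥ 1 and n(s) = N for all s ≥ t'' for some t''. Fix any t' ≥ 1 (the time the agent joined). Then the sequence (∑_{s=t'}^{t} (c(s) − c(s−1))/n(s)) / c(t), with real-valued division, converges to 1/N as t → ∞. -/
open Filter

/-- Under egalitarian minting, the accumulated income of an agent who joined at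
time `t'`, diluted by the total coin count, converges to an equal share `1/N`. -/
theorem egalitarian_minting_income_share
    (N : ℕ) (hN : 1 ≤ N)
    (c : ℕ → ℕ) (hc : Monotone c) (hclim : Tendsto c atTop atTop)
    (n : ℕ → ℕ) (hn : ∀ s : ℕ, 1 ≤ s → 1 ≤ n s ∧ n s ≤ N)
    (t'' : ℕ) (hfinal : ∀ s : ℕ, t'' ≤ s → n s = N)
    (t' : ℕ) (ht' : 1 ≤ t') :
    Tendsto
      (fun t : ℕ =>
        (∑ s ∈ Finset.Icc t' t, ((c s : ℝ) - (c (s - 1) : ℝ)) / (n s : ℝ)) / (c t : ℝ))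
      atTop (nhds (1 / (N : ℝ))) := by
  obtain ⟨K, T, hK⟩ : ∃ (K : ℝ) (T : ℕ), ∀ t, T ≤ t →
      ∑ s ∈ Finset.Icc t' t, ((c s : ℝ) - (c (s - 1) : ℝ)) / (n s : ℝ) = c t / N + K := by
    refine ⟨(∑ s ∈ Finset.Icc t' (max t' t''), ((c s : ℝ) - (c (s - 1) : ℝ)) / (n s : ℝ))
      - c (max t' t'') / N, max t' t'', fun t ht => ?_⟩
    induction t, ht using Nat.le_induction with
    | base => ring
    | succ t ht ih =>
      rw [Finset.sum_Icc_succ_top (by omega), ih, hfinal (t + 1) (by omega), Nat.add_sub_cancel]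
      ring
  have hcR : Tendsto (fun t => (c t : ℝ)) atTop atTop :=
    tendsto_natCast_atTop_atTop.comp hclim
  have hlim : Tendsto (fun t => 1 / (N : ℝ) + K / c t) atTop (nhds (1 / (N : ℝ))) := by
    simpa using (hcR.const_div_atTop K).const_add (1 / (N : ℝ))
  refine hlim.congr' ?_
  filter_upwards [eventually_ge_atTop T, hcR.eventually_gt_atTop 0] with t ht hpos
  rw [hK t ht]
  field_simp
end

section
/- Let N ≥ 1 be a natural number, let c : ℕ → ℕ be a nondecreasing sequence with c(t) → ∞, and let n : ℕ → ℕ satisfy 1 ≤ n(s) ≤ N for all s ≥ 1 and n(s) = N for all s ≥ t'' for some t''. Fix t' ≥ 1, let rev, exp : ℕ → ℝ be arbitrary, define m(s) = (c(s) − c(s−1))/n(s) for s ≥ t' and m(s) = 0 for s < t', and define b : ℕ → ℝ by b(t) = b(0) + ∑_{s=1}^{t} (m(s) + rev(s) − exp(s)) for an arbitrary real b(0) ≥ 0. Then (b(t) − ∑_{s=1}^{t} (rev(s) − exp(s))) / c(t) → 1/N as t → ∞. That is, a currency community history that employs egalitarian minting with |C_t| → ∞ and finitely many agents is asymptotically just.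 -/
open Filter

/-- If the increments of `f` are eventually `a` times those of `c`, and `c` tends to infinity,
then `f / c` tends to `a`. -/
theorem tendsto_div_of_increments_eq_mul {f c : ℕ → ℝ} {a : ℝ} {T : ℕ}
    (hc : Tendsto c atTop atTop)
    (h : ∀ t, T ≤ t → f (t + 1) - f t = a * (c (t + 1) - c t)) :
    Tendsto (fun t => f t / c t) atTop (nhds a) := by
  have key : ∀ t, T ≤ t → f t = (f T - a * c T) + a * c t := by
    intro t ht
    induction t, ht using Nat.le_induction with
    | base => ring
    | succ t ht ih => linarith [h t ht]
  have hlim : Tendsto (fun t => (f T - a * c T) / c t + a) atTop (nhds a) := by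
    simpa using (hc.const_div_atTop (f T - a * c T)).add_const a
  refine hlim.congr' ?_
  filter_upwards [eventually_ge_atTop T, hc.eventually_gt_atTop 0] with t ht hpos
  rw [key t ht, add_div, mul_div_cancel_right₀ a hpos.ne']

/-- A currency community history that employs egalitarian minting with
`|C_t| → ∞` and finitely many agents is asymptotically just. -/
theorem egalitarian_minting_asymptotically_just
    (N : ℕ) (hN : 1 ≤ N)
    (c : ℕ → ℕ) (hc : Monotone c) (hclim : Tendsto c atTop atTop)
    (n : ℕ → ℕ) (hn : ∀ s : ℕ, 1 ≤ s → 1 ≤ n s ∧ n s ≤ N)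
    (t'' : ℕ) (hfinal : ∀ s : ℕ, t'' ≤ s → n s = N)
    (t' : ℕ) (ht' : 1 ≤ t')
    (rev exp m : ℕ → ℝ)
    (hm1 : ∀ s : ℕ, t' ≤ s → m s = ((c s : ℝ) - (c (s - 1) : ℝ)) / (n s : ℝ))
    (hm2 : ∀ s : ℕ, s < t' → m s = 0)
    (b : ℕ → ℝ) (hb0 : 0 ≤ b 0)
    (hb : ∀ t : ℕ, b t = b 0 + ∑ s ∈ Finset.Icc 1 t, (m s + rev s - exp s)) :
    Tendsto
      (fun t : ℕ => (b t - ∑ s ∈ Finset.Icc 1 t, (rev s - exp s)) / (c t : ℝ))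
      atTop (nhds (1 / (N : ℝ))) := by
  refine tendsto_div_of_increments_eq_mul (T := max t' t'')
    (tendsto_natCast_atTop_atTop.comp hclim) fun t ht => ?_
  have h1 : t' ≤ t + 1 := by omega
  have h2 : t'' ≤ t + 1 := by omega
  rw [hb (t + 1), hb t, Finset.sum_Icc_succ_top (by omega), Finset.sum_Icc_succ_top (by omega),
    hm1 _ h1, hfinal _ h2]
  simp only [Nat.add_sub_cancel]
  ring
end

section
/- Let x be a real number with 0 ≤ x ≤ 1, and let a : ℕ → ℕ satisfy a(0) = 0 and a(t+1) ∈ {a(t), a(t)+1} for all t. Suppose that for every ε > 0 there exists T such that for all t ≥ T: if (a(t) : ℝ)/t < x − ε then a(t+1) = a(t) + 1, and if (a(t) : ℝ)/t > x + ε then a(t+1) = a(t). Then (a(t) : ℝ)/t → x as t → ∞. -/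
open Filter

/-- A sequence with increments at most `1` that does not increase while positive is eventually
bounded by any `C ≥ 1` which bounds it at the starting time. -/
lemma le_of_increments_le_one_of_antitone_of_pos {v : ℕ → ℝ} {C : ℝ} {T : ℕ} (hC : 1 ≤ C)
    (hT : v T ≤ C) (hone : ∀ t, T ≤ t → v (t + 1) ≤ v t + 1)
    (hpos : ∀ t, T ≤ t → 0 < v t → v (t + 1) ≤ v t) {t : ℕ} (ht : T ≤ t) : v t ≤ C := by
  induction t, ht using Nat.le_induction with
  | base => exact hT
  | succ t ht ih =>
    rcases lt_or_ge 0 (v t) with h | h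
    · exact (hpos t ht h).trans ih
    · linarith [hone t ht]

/-- A counting sequence whose fraction `a t / t` drifts upwards when below `x`
and stays whenever it is above `x` converges to `x`. -/
theorem drift_fraction_converges
    (x : ℝ) (hx0 : 0 ≤ x) (hx1 : x ≤ 1)
    (a : ℕ → ℕ) (ha0 : a 0 = 0)
    (hstep : ∀ t : ℕ, a (t + 1) = a t ∨ a (t + 1) = a t + 1)
    (hdrift : ∀ ε : ℝ, 0 < ε → ∃ T : ℕ, ∀ t : ℕ, T ≤ t →
      ((a t : ℝ) / (t : ℝ) < x - ε → a (t + 1) = a t + 1) ∧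
      ((a t : ℝ) / (t : ℝ) > x + ε → a (t + 1) = a t)) :
    Tendsto (fun t : ℕ => (a t : ℝ) / (t : ℝ)) atTop (nhds x) := by
  have hle (t : ℕ) : a t ≤ t := by
    induction t with
    | zero => exact ha0.le
    | succ t ih => have := hstep t; omega
  have hlow (t : ℕ) : (a t : ℝ) ≤ a (t + 1) := by
    have := hstep t
    exact_mod_cast (by omega : a t ≤ a (t + 1))
  have hupp (t : ℕ) : (a (t + 1) : ℝ) ≤ a t + 1 := by
    have := hstep t
    exact_mod_cast (by omega : a (t + 1) ≤ a t + 1)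
  rw [Metric.tendsto_atTop]
  intro ε hε
  obtain ⟨T, hT⟩ := hdrift (ε / 2) (by positivity)
  have hcast (t : ℕ) (ht : T + 1 ≤ t) : (0 : ℝ) < t := by
    exact_mod_cast (by omega : 0 < t)
  have hTle : (a (T + 1) : ℝ) ≤ T + 1 := by exact_mod_cast hle (T + 1)
  have hT0 : (0 : ℝ) ≤ T := T.cast_nonneg
  have ha_nonneg : (0 : ℝ) ≤ a (T + 1) := Nat.cast_nonneg _
  have habove {t : ℕ} (ht : T + 1 ≤ t) : (a t : ℝ) - (x + ε / 2) * t ≤ T + 1 := by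
    refine le_of_increments_le_one_of_antitone_of_pos
      (v := fun t : ℕ => (a t : ℝ) - (x + ε / 2) * t) (by linarith) ?_ ?_ ?_ ht
    · push_cast
      nlinarith
    · intro t _
      push_cast
      linarith [hupp t]
    · intro t ht hpos
      have h := (hT t (by omega)).2 ((lt_div_iff₀ (hcast t ht)).2 (sub_pos.1 hpos))
      push_cast [h]
      linarith
  have hbelow {t : ℕ} (ht : T + 1 ≤ t) : (x - ε / 2) * t - (a t : ℝ) ≤ T + 1 := by
    refine le_of_increments_le_one_of_antitone_of_pos
      (v := fun t : ℕ => (x - ε / 2) * t - (a t : ℝ)) (by linarith) ?_ ?_ ?_ ht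
    · push_cast
      nlinarith
    · intro t _
      push_cast
      linarith [hlow t]
    · intro t ht hpos
      have h := (hT t (by omega)).1 ((div_lt_iff₀ (hcast t ht)).2 (sub_pos.1 hpos))
      push_cast [h]
      linarith
  obtain ⟨N, hN⟩ := exists_nat_gt ((T + 1 : ℝ) / (ε / 2))
  refine ⟨max N (T + 1), fun t ht => ?_⟩
  have htT : T + 1 ≤ t := (le_max_right _ _).trans ht
  have hNt : (N : ℝ) ≤ t := by exact_mod_cast (le_max_left _ _).trans ht
  have hlt : (T + 1 : ℝ) < t * (ε / 2) := (div_lt_iff₀ (by positivity)).1 (hN.trans_le hNt)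
  rw [Real.dist_eq, abs_sub_lt_iff, sub_lt_iff_lt_add, sub_lt_comm,
    div_lt_iff₀ (hcast t htT), lt_div_iff₀ (hcast t htT)]
  constructor
  · linarith [habove htT]
  · linarith [hbelow htT]
end

section
/- Let n1, n2, m be natural numbers with n1 > 0, n2 > 0 and m > 0 (the sizes of V^1 \ V^2, V^2 \ V^1 and V^1 ∩ V^2). Let L : ℕ → ℝ be a sequence with L(t) > 0 for all t that converges to a real number L∞ satisfying n1/(n2 + m) ≤ L∞ ≤ (n1 + m)/n2. Let a : ℕ → ℕ satisfy a(0) = 0, a(1) ∈ {0, 1}, and for all t ≥ 1: a(t+1) = a(t) + 1 if L(t)·(t·n2 + (t − a(t))·m)/(t·n1 + a(t)·m) ≥ 1, and a(t+1) = a(t) otherwise (myopic minting: intersection agents mint a currency-1 coin exactly when it is the most valued coin). Then (t·n1 + a(t)·m)/(t·n2 + (t − a(t))·m) → L∞ and the exchange-rate sequence EX(t) := L(t)·(t·n2 + (t − a(t))·m)/(t·n1 + a(t)·m) converges to 1. (Main theorem: under joint egalitarian minting with myopic agents, an efficient network whose community intersection is sufficiently large relative to the productivity gap has exchange rates converging to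 1:1.) -/
open Filter

/-- A counter that increases by one exactly when it is at most `t * ξ t` has asymptotic
density `lim ξ`, provided this limit lies in `[0, 1]`. -/
theorem tendsto_div_of_threshold_step (a : ℕ → ℕ) (ξ : ℕ → ℝ) (x : ℝ)
    (hξ : Tendsto ξ atTop (nhds x)) (hx0 : 0 ≤ x) (hx1 : x ≤ 1)
    (hup : ∀ t : ℕ, 1 ≤ t → (a t : ℝ) ≤ t * ξ t → a (t + 1) = a t + 1)
    (hstay : ∀ t : ℕ, 1 ≤ t → t * ξ t < a t → a (t + 1) = a t) :
    Tendsto (fun t : ℕ => (a t : ℝ) / t) atTop (nhds x) := by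
  rw [Metric.tendsto_atTop]
  intro ε hε
  obtain ⟨T, hT⟩ := Metric.tendsto_atTop.1 hξ (ε / 2) (half_pos hε)
  set S := max T 1 with hS
  set C := |(a S : ℝ) - S * x| with hC
  have key : ∀ t : ℕ, S ≤ t → |(a t : ℝ) - t * x| ≤ C + 1 + ε / 2 * t := by
    intro t ht
    induction t, ht using Nat.le_induction with
    | base =>
      have : 0 ≤ ε / 2 * (S : ℝ) := by positivity
      linarith
    | succ t ht ih =>
      have hC0 : 0 ≤ C := abs_nonneg _
      have ht0 : (0 : ℝ) ≤ t := t.cast_nonneg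
      have hclose := hT t (le_trans (le_max_left _ _) ht)
      rw [Real.dist_eq, abs_lt] at hclose
      have hlow : t * x - ε / 2 * t ≤ t * ξ t := by nlinarith
      have hhigh : t * ξ t ≤ t * x + ε / 2 * t := by nlinarith
      have ht1 : 1 ≤ t := le_trans (le_max_right _ _) ht
      rw [abs_le] at ih ⊢
      rcases le_or_gt (a t : ℝ) (t * ξ t) with h | h
      · rw [hup t ht1 h]
        push_cast
        constructor <;> linarith
      · rw [hstay t ht1 h]
        push_cast
        constructor <;> linarith
  obtain ⟨N, hN⟩ := exists_nat_gt ((C + 1) / (ε / 2))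
  refine ⟨max S N, fun t ht => ?_⟩
  have hSt : S ≤ t := le_trans (le_max_left _ _) ht
  have htpos : (0 : ℝ) < t := by
    exact_mod_cast (le_trans (le_max_right T 1) hSt : 1 ≤ t)
  have hNt : (N : ℝ) ≤ t := by exact_mod_cast le_trans (le_max_right _ _) ht
  have hlarge : C + 1 < t * (ε / 2) := (div_lt_iff₀ (half_pos hε)).1 (hN.trans_le hNt)
  have hdiff : (a t : ℝ) / t - x = ((a t : ℝ) - t * x) / t := by field_simp
  rw [Real.dist_eq, hdiff, abs_div, abs_of_pos htpos, div_lt_iff₀ htpos]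
  linarith [key t hSt]

/-- Main theorem: under joint egalitarian minting with myopic agents, in an
efficient network whose community intersection is sufficiently large relative to
the productivity gap, the coin-volume ratio converges to the limiting marginal
rate of substitution and the exchange rate converges to 1:1. -/
theorem joint_egalitarian_minting_exchange_rate_converges
    (n1 n2 m : ℕ) (h1 : 0 < n1) (h2 : 0 < n2) (h3 : 0 < m)
    (L : ℕ → ℝ) (hLpos : ∀ t, 0 < L t)
    (Linf : ℝ) (hLlim : Tendsto L atTop (nhds Linf))
    (hlo : (n1 : ℝ) / ((n2 : ℝ) + (m : ℝ)) ≤ Linf)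
    (hhi : Linf ≤ ((n1 : ℝ) + (m : ℝ)) / (n2 : ℝ))
    (a : ℕ → ℕ) (ha0 : a 0 = 0) (ha1 : a 1 = 0 ∨ a 1 = 1)
    (hstep : ∀ t : ℕ, 1 ≤ t →
      (1 ≤ L t * ((t * n2 + (t - a t) * m : ℕ) : ℝ) / ((t * n1 + a t * m : ℕ) : ℝ) →
        a (t + 1) = a t + 1) ∧
      (L t * ((t * n2 + (t - a t) * m : ℕ) : ℝ) / ((t * n1 + a t * m : ℕ) : ℝ) < 1 →
        a (t + 1) = a t)) :
    Tendsto
      (fun t : ℕ =>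
        ((t * n1 + a t * m : ℕ) : ℝ) / ((t * n2 + (t - a t) * m : ℕ) : ℝ))
      atTop (nhds Linf) ∧
    Tendsto
      (fun t : ℕ =>
        L t * ((t * n2 + (t - a t) * m : ℕ) : ℝ) / ((t * n1 + a t * m : ℕ) : ℝ))
      atTop (nhds 1) := by
  have hn1 : (0 : ℝ) < n1 := by exact_mod_cast h1
  have hn2 : (0 : ℝ) < n2 := by exact_mod_cast h2
  have hm : (0 : ℝ) < m := by exact_mod_cast h3
  have hLinf : 0 < Linf := lt_of_lt_of_le (by positivity) hlo
  have hle : ∀ t, a t ≤ t := by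
    intro t
    induction t with
    | zero => exact ha0.le
    | succ t ih =>
      rcases Nat.eq_zero_or_pos t with rfl | ht
      · rcases ha1 with h | h <;> simp [h]
      · rcases le_or_gt 1 (L t * ((t * n2 + (t - a t) * m : ℕ) : ℝ) /
            ((t * n1 + a t * m : ℕ) : ℝ)) with h | h
        · rw [(hstep t ht).1 h]; omega
        · rw [(hstep t ht).2 h]; omega
  have hvol1 : ∀ t : ℕ, ((t * n1 + a t * m : ℕ) : ℝ) = t * n1 + a t * m := by
    intro t; push_cast; ring
  have hvol2 : ∀ t : ℕ,
      ((t * n2 + (t - a t) * m : ℕ) : ℝ) = t * n2 + (t - a t) * m := by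
    intro t; push_cast [Nat.cast_sub (hle t)]; ring
  simp only [hvol1, hvol2] at hstep ⊢
  set ξ : ℝ → ℝ := fun l => (l * (n2 + m) - n1) / (m * (1 + l)) with hξ
  have hdensity : Tendsto (fun t : ℕ => (a t : ℝ) / t) atTop (nhds (ξ Linf)) := by
    have hrate : ∀ t : ℕ, 1 ≤ t →
        (1 ≤ L t * (t * n2 + (t - a t) * m) / (t * n1 + a t * m) ↔
          (a t : ℝ) ≤ t * ξ (L t)) := by
      intro t ht
      have ht0 : (0 : ℝ) < t := by exact_mod_cast ht
      have hL := hLpos t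
      have hden : (0 : ℝ) < t * n1 + a t * m := by positivity
      rw [one_le_div hden, hξ, ← mul_div_assoc, le_div_iff₀ (by positivity)]
      constructor <;> intro h <;> linarith
    refine tendsto_div_of_threshold_step a (fun t => ξ (L t)) (ξ Linf) ?_ ?_ ?_
      (fun t ht h => (hstep t ht).1 ((hrate t ht).2 h))
      (fun t ht h => (hstep t ht).2 (not_le.1 fun h' => h.not_ge ((hrate t ht).1 h')))
    · exact ((hLlim.mul_const _).sub_const _).div ((hLlim.const_add 1).const_mul _)
        (by positivity)
    · rw [div_le_iff₀ (by positivity)] at hlo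
      exact div_nonneg (by linarith) (by positivity)
    · rw [le_div_iff₀ hn2] at hhi
      exact (div_le_one (by positivity)).2 (by linarith)
  have hratio : Tendsto
      (fun t : ℕ => ((t : ℝ) * n1 + a t * m) / (t * n2 + (t - a t) * m))
      atTop (nhds Linf) := by
    have hden : (n2 : ℝ) + (1 - ξ Linf) * m = (n1 + n2 + m) / (1 + Linf) := by
      simp only [hξ]
      field_simp
      ring
    have hnum : (n1 : ℝ) + ξ Linf * m = Linf * ((n1 + n2 + m) / (1 + Linf)) := by
      simp only [hξ]
      field_simp
      ring
    have hden_pos : (0 : ℝ) < (n1 + n2 + m) / (1 + Linf) := by positivity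
    have hlim := ((hdensity.mul_const (m : ℝ)).const_add (n1 : ℝ)).div
      (((hdensity.const_sub 1).mul_const (m : ℝ)).const_add (n2 : ℝ))
      (by rw [hden]; exact hden_pos.ne')
    rw [hden, hnum, mul_div_cancel_right₀ _ hden_pos.ne'] at hlim
    refine hlim.congr' ?_
    filter_upwards [eventually_gt_atTop 0] with t ht
    have ht0 : (t : ℝ) ≠ 0 := by exact_mod_cast ht.ne'
    simp only [Pi.div_apply]
    rw [← mul_div_mul_left _ _ ht0]
    congr 1 <;> field_simp
  refine ⟨hratio, ?_⟩
  have hrate := hLlim.div hratio hLinf.ne'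
  rw [div_self hLinf.ne'] at hrate
  refine hrate.congr fun t => ?_
  simp only [Pi.div_apply, div_div_eq_mul_div]
end
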